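/- Let A be a real symmetric N×N matrix (N ≥ 1) with A·𝟙 = 𝟙 and such that ‖A·y‖ ≤ α‖y‖ for every y ∈ ℝ^N orthogonal to 𝟙, where 0 ≤ α ≤ 1 and β = 1 − α. Let B be an N×N permutation matrix and set A' = A·B. Let S, S' ⊆ {0, 1, …, N−1} with projection matrices P = P_S and P' = P_{S'}, and set μ = |S|/N, μ' = |S'|/N. Then for every row vector v ∈ ℝ^N: ‖v·P·A'·P'‖ ≤ ‖v‖·(α + βμ)^{1/2}·(α + βμ')^{1/2} (equivalently, ‖(P·A·B·P')ᵀ·v‖ ≤ ‖v‖·(α + βμ)^{1/2}·(α + βμ')^{1/2} for every column vector v). -/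

import Mathlib

open Finset Matrix

/-- The Euclidean norm of a vector in `Fin N → ℝ`. -/
noncomputable def euclNorm {N : ℕ} (v : Fin N → ℝ) : ℝ :=
  Real.sqrt (∑ i, v i ^ 2)

/-- The projection matrix of a set `S` of coordinates: the diagonal 0/1 matrix with a `1`
exactly at the positions in `S`. -/
def projMat {N : ℕ} (S : Finset (Fin N)) : Matrix (Fin N) (Fin N) ℝ :=
  Matrix.diagonal (fun i => if i ∈ S then 1 else 0)

theorem euclNorm_eq_sqrt_dotProduct {N : ℕ} (v : Fin N → ℝ) :
    euclNorm v = Real.sqrt (v ⬝ᵥ v) := by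
  simp [euclNorm, dotProduct, sq]

theorem dotProduct_self_nonneg_real {ι : Type*} [Fintype ι] (v : ι → ℝ) : 0 ≤ v ⬝ᵥ v :=
  Finset.sum_nonneg fun i _ => mul_self_nonneg (v i)

theorem sq_dotProduct_le_mul {ι : Type*} [Fintype ι] (v w : ι → ℝ) :
    (v ⬝ᵥ w) ^ 2 ≤ (v ⬝ᵥ v) * (w ⬝ᵥ w) := by
  simpa [dotProduct, sq] using Finset.sum_mul_sq_le_sq_mul_sq Finset.univ v w

theorem sq_add_le_mul_add {c m U V P Q : ℝ} (hU : 0 ≤ U) (hV : 0 ≤ V) (hP : 0 ≤ P)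
    (hQ : 0 ≤ Q) (hc : c ^ 2 ≤ U * V) (hm : m ^ 2 ≤ P * Q) :
    (c + m) ^ 2 ≤ (U + P) * (V + Q) := by
  have h : 2 * c * m ≤ U * Q + V * P := by
    apply le_of_sq_le_sq _ (by positivity)
    have := mul_le_mul hc hm (sq_nonneg m) (by positivity)
    nlinarith [sq_nonneg (U * Q - V * P)]
  nlinarith

theorem sq_sum_le_card_mul_dotProduct {ι : Type*} [Fintype ι] (S : Finset ι) (x : ι → ℝ)
    (hx : ∀ i ∉ S, x i = 0) : (∑ i, x i) ^ 2 ≤ S.card * (x ⬝ᵥ x) := by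
  have h₁ : ∑ i ∈ S, x i = ∑ i, x i :=
    Finset.sum_subset (Finset.subset_univ S) fun i _ hi => hx i hi
  have h₂ : ∑ i ∈ S, x i ^ 2 = x ⬝ᵥ x := by
    rw [Finset.sum_subset (Finset.subset_univ S) fun i _ hi => by simp [hx i hi]]
    simp [dotProduct, sq]
  rw [← h₁, ← h₂]
  exact sq_sum_le_card_mul_sum_sq

/-- A symmetric matrix that fixes the all-ones vector and contracts its orthogonal complement
by `α` satisfies a mixing inequality in terms of coordinate sums. -/
theorem sq_dotProduct_mulVec_le_of_contract {N : ℕ} (hN : 1 ≤ N)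
    (A : Matrix (Fin N) (Fin N) ℝ) (hsymm : A.IsSymm)
    (hones : A.mulVec (fun _ => 1) = fun _ => 1) (α : ℝ) (hα0 : 0 ≤ α)
    (hcontract : ∀ y : Fin N → ℝ, (∑ i, y i * 1) = 0 →
      euclNorm (A.mulVec y) ≤ α * euclNorm y) (x y : Fin N → ℝ) :
    (x ⬝ᵥ A *ᵥ y) ^ 2 ≤
      (α * (x ⬝ᵥ x) + (1 - α) * ((∑ i, x i) ^ 2 / N)) *
        (α * (y ⬝ᵥ y) + (1 - α) * ((∑ i, y i) ^ 2 / N)) := by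
  have hN' : (N : ℝ) ≠ 0 := by positivity
  set e : Fin N → ℝ := fun _ => 1 with he
  have hee : e ⬝ᵥ e = N := by simp [he, dotProduct]
  have hsum (z : Fin N → ℝ) : z ⬝ᵥ e = ∑ i, z i := by simp [he, dotProduct]
  have hdecomp (z : Fin N → ℝ) : ∃ z' : Fin N → ℝ, z = ((∑ i, z i) / N) • e + z' ∧
      z' ⬝ᵥ e = 0 ∧ z' ⬝ᵥ z' = z ⬝ᵥ z - (∑ i, z i) ^ 2 / N := by
    refine ⟨z - ((∑ i, z i) / N) • e, by simp, ?_, ?_⟩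
    · rw [sub_dotProduct, smul_dotProduct, hee, hsum, smul_eq_mul]
      field_simp
      ring
    · simp only [sub_dotProduct, dotProduct_sub, smul_dotProduct, dotProduct_smul, hee, hsum z,
        dotProduct_comm e z, smul_eq_mul]
      field_simp
      ring
  obtain ⟨x', hx, hx'e, hx'x'⟩ := hdecomp x
  obtain ⟨y', hy, hy'e, hy'y'⟩ := hdecomp y
  set s := ∑ i, x i
  set t := ∑ i, y i
  have hAy : (A *ᵥ y') ⬝ᵥ (A *ᵥ y') ≤ α ^ 2 * (y' ⬝ᵥ y') := by
    have h := hcontract y' (by simpa [he, dotProduct] using hy'e)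
    rw [euclNorm_eq_sqrt_dotProduct, euclNorm_eq_sqrt_dotProduct] at h
    have h2 := pow_le_pow_left₀ (Real.sqrt_nonneg _) h 2
    rwa [mul_pow, Real.sq_sqrt (dotProduct_self_nonneg_real _),
      Real.sq_sqrt (dotProduct_self_nonneg_real _)] at h2
  have heA : e ⬝ᵥ A *ᵥ y' = 0 := by
    rw [dotProduct_mulVec, ← mulVec_transpose, hsymm.eq, hones, dotProduct_comm, hy'e]
  have hmain : x ⬝ᵥ A *ᵥ y = s * t / N + x' ⬝ᵥ A *ᵥ y' := by
    rw [hx, hy]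
    simp only [mulVec_add, mulVec_smul, hones, add_dotProduct, dotProduct_add, smul_dotProduct,
      dotProduct_smul, hee, heA, hx'e, smul_eq_mul]
    field_simp
    ring
  have hX := dotProduct_self_nonneg_real x'
  have hY := dotProduct_self_nonneg_real y'
  have hm : (x' ⬝ᵥ A *ᵥ y') ^ 2 ≤ (α * (x' ⬝ᵥ x')) * (α * (y' ⬝ᵥ y')) := by
    have := mul_le_mul_of_nonneg_left hAy hX
    linarith [sq_dotProduct_le_mul x' (A *ᵥ y')]
  have hc : (s * t / N) ^ 2 ≤ (s ^ 2 / N) * (t ^ 2 / N) := by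
    apply le_of_eq
    field_simp
  rw [hmain]
  refine (sq_add_le_mul_add (by positivity) (by positivity) (by positivity) (by positivity)
    hc hm).trans_eq ?_
  rw [hx'x', hy'y']
  ring

/-- Let `A` be a real symmetric `N×N` matrix fixing the all-ones vector
and contracting by a factor `α ∈ [0,1]` on the orthogonal complement of the all-ones
vector, `β = 1 - α`, `B` the permutation matrix of a permutation `F`, and `A' = A·B`.
If `P, P'` are the projection matrices of sets `S, S'` of densities `μ, μ'`, then for
every row vector `v`, `‖v·P·A'·P'‖ ≤ ‖v‖·√(α + βμ)·√(α + βμ')`. -/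
theorem projected_expander_permutation_operator_bound
    (N : ℕ) (hN : 1 ≤ N)
    (A : Matrix (Fin N) (Fin N) ℝ) (hsymm : A.IsSymm)
    (hones : A.mulVec (fun _ => 1) = fun _ => 1)
    (α : ℝ) (hα0 : 0 ≤ α) (hα1 : α ≤ 1)
    (hcontract : ∀ y : Fin N → ℝ, (∑ i, y i * 1) = 0 →
      euclNorm (A.mulVec y) ≤ α * euclNorm y)
    (β : ℝ) (hβ : β = 1 - α)
    (F : Equiv.Perm (Fin N))
    (B : Matrix (Fin N) (Fin N) ℝ) (hB : ∀ i j, B i j = if F i = j then 1 else 0)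
    (A' : Matrix (Fin N) (Fin N) ℝ) (hA' : A' = A * B)
    (S S' : Finset (Fin N))
    (μ μ' : ℝ) (hμ : μ = (S.card : ℝ) / N) (hμ' : μ' = (S'.card : ℝ) / N)
    (v : Fin N → ℝ) :
    euclNorm (Matrix.vecMul v (projMat S * A' * projMat S')) ≤
      euclNorm v * Real.sqrt (α + β * μ) * Real.sqrt (α + β * μ') := by
  have hx0 : ∀ i ∉ S, (v ᵥ* projMat S) i = 0 := fun i hi => by
    simp [projMat, vecMul_diagonal, hi]
  have hxv : (v ᵥ* projMat S) ⬝ᵥ (v ᵥ* projMat S) ≤ v ⬝ᵥ v := by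
    refine Finset.sum_le_sum fun i _ => ?_
    by_cases hi : i ∈ S <;> simp [projMat, vecMul_diagonal, hi, mul_self_nonneg]
  have hβ0 : 0 ≤ β := by linarith
  have hμ0 : 0 ≤ μ := by rw [hμ]; positivity
  have hμ'0 : 0 ≤ μ' := by rw [hμ']; positivity
  rw [← vecMul_vecMul, ← vecMul_vecMul, hA', ← vecMul_vecMul]
  set x := v ᵥ* projMat S
  set w := x ᵥ* A ᵥ* B ᵥ* projMat S' with hw
  have hw0 : ∀ i ∉ S', w i = 0 := fun i hi => by
    simp [hw, projMat, vecMul_diagonal, hi, -vecMul_vecMul]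
  have hBw : B *ᵥ w = w ∘ F := by
    ext i
    simp [mulVec, dotProduct, hB]
  have hww : w ⬝ᵥ w = x ⬝ᵥ A *ᵥ (w ∘ F) := by
    rw [← hBw, dotProduct_mulVec, dotProduct_mulVec]
    refine Finset.sum_congr rfl fun i _ => ?_
    by_cases hi : i ∈ S'
    · simp [hw, projMat, vecMul_diagonal, hi, -vecMul_vecMul]
    · simp [hw0 i hi]
  have hnorm : (w ∘ F) ⬝ᵥ (w ∘ F) = w ⬝ᵥ w := Equiv.sum_comp F fun i => w i * w i
  have hsum : ∑ i, (w ∘ F) i = ∑ i, w i := Equiv.sum_comp F w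
  have hmix := sq_dotProduct_mulVec_le_of_contract hN A hsymm hones α hα0 hcontract x (w ∘ F)
  rw [← hww, hnorm, hsum, ← hβ] at hmix
  have hbound (T : Finset (Fin N)) (z : Fin N → ℝ) (hz : ∀ i ∉ T, z i = 0) :
      α * (z ⬝ᵥ z) + β * ((∑ i, z i) ^ 2 / N) ≤ (α + β * ((T.card : ℝ) / N)) * (z ⬝ᵥ z) := by
    have h : (∑ i, z i) ^ 2 / N ≤ T.card * (z ⬝ᵥ z) / N := by
      gcongr
      exact sq_sum_le_card_mul_dotProduct T z hz
    have := mul_le_mul_of_nonneg_left h hβ0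
    calc _ ≤ α * (z ⬝ᵥ z) + β * (T.card * (z ⬝ᵥ z) / N) := by linarith
      _ = _ := by ring
  have hbx := hbound S x hx0
  have hbw := hbound S' w hw0
  rw [← hμ] at hbx
  rw [← hμ'] at hbw
  have hx_nonneg := dotProduct_self_nonneg_real x
  have hw_nonneg := dotProduct_self_nonneg_real w
  have hsq := hmix.trans (mul_le_mul hbx hbw (by positivity) (by positivity))
  have hwx : w ⬝ᵥ w ≤ (x ⬝ᵥ x) * (α + β * μ) * (α + β * μ') := by
    rcases hw_nonneg.eq_or_lt with h | h
    · rw [← h]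
      positivity
    · refine le_of_mul_le_mul_right ?_ h
      linarith
  rw [euclNorm_eq_sqrt_dotProduct, euclNorm_eq_sqrt_dotProduct,
    ← Real.sqrt_mul (dotProduct_self_nonneg_real v),
    ← Real.sqrt_mul (mul_nonneg (dotProduct_self_nonneg_real v) (by positivity))]
  apply Real.sqrt_le_sqrt
  refine hwx.trans ?_
  gcongr
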